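/- For every integer d ≥ 2, the graph Lad_{d+} (the square of the path on 2d+1 vertices) has strong rainbow connection number src(Lad_{d+}) = d. -/

import Mathlib

open SimpleGraph

/-- An edge-coloring `c` (colors on unordered pairs; only values on edges matter)
is a rainbow coloring of `G` if every pair of vertices is joined by a path
whose edges receive pairwise distinct colors. -/
def IsRainbowColoring {V α : Type*} (G : SimpleGraph V) (c : Sym2 V → α) : Prop :=
  ∀ u v : V, ∃ p : G.Walk u v, p.IsPath ∧ (p.edges.map c).Nodup

/-- The rainbow connection number: the least `n` such that `G` has a rainbow
coloring using colors from `Fin n`. -/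
noncomputable def rc {V : Type*} (G : SimpleGraph V) : ℕ :=
  sInf {n : ℕ | ∃ c : Sym2 V → Fin n, IsRainbowColoring G c}

/-- The eccentricity of a vertex: the largest distance from it to another vertex. -/
noncomputable def eccentricity {V : Type*} [Fintype V] (G : SimpleGraph V) (v : V) : ℕ :=
  Finset.univ.sup fun u => G.dist v u

/-- The diameter: the largest distance between a pair of vertices. -/
noncomputable def graphDiam {V : Type*} [Fintype V] (G : SimpleGraph V) : ℕ :=
  Finset.univ.sup fun p : V × V => G.dist p.1 p.2

/-- The radius: the least eccentricity of a vertex. -/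
noncomputable def graphRadius {V : Type*} [Fintype V] (G : SimpleGraph V) : ℕ :=
  sInf (Set.range (eccentricity G))

/-- An edge-coloring `c` is a strong rainbow coloring of `G` if every pair of
vertices is joined by a rainbow geodesic: a path with pairwise distinctly
colored edges whose length equals the distance between its endpoints. -/
def IsStrongRainbowColoring {V α : Type*} (G : SimpleGraph V) (c : Sym2 V → α) : Prop :=
  ∀ u v : V, ∃ p : G.Walk u v, p.IsPath ∧ (p.edges.map c).Nodup ∧ p.length = G.dist u v

/-- The strong rainbow connection number: the least `n` such that `G` has a
strong rainbow coloring using colors from `Fin n`. -/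
noncomputable def src {V : Type*} (G : SimpleGraph V) : ℕ :=
  sInf {n : ℕ | ∃ c : Sym2 V → Fin n, IsStrongRainbowColoring G c}

/-- The square of the path on `n` vertices: distinct vertices `i`, `j` are
adjacent iff `|i - j| ≤ 2`. For `n = 2 * d + 1` this is the graph `Lad_{d+}`. -/
def lad (n : ℕ) : SimpleGraph (Fin n) :=
  SimpleGraph.fromRel fun i j => |(i : ℤ) - (j : ℤ)| ≤ 2

theorem lad_adj_iff {n : ℕ} {i j : Fin n} :
    (lad n).Adj i j ↔ i ≠ j ∧ (j : ℕ) ≤ i + 2 ∧ (i : ℕ) ≤ j + 2 := by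
  simp only [lad, SimpleGraph.fromRel_adj, abs_le]
  refine and_congr_right fun _ => ?_
  omega

/-- Every edge of `lad n` changes the index by at most two. -/
theorem le_add_two_mul_length_of_walk_lad {n : ℕ} {i j : Fin n} (p : (lad n).Walk i j) :
    (j : ℕ) ≤ i + 2 * p.length := by
  induction p with
  | nil => simp
  | cons h p ih =>
    have := (lad_adj_iff.1 h).2.1
    rw [SimpleGraph.Walk.length_cons]
    omega

/-- The edges `{2s, 2s + 1}` get the last color, every other edge `{i, j}` with `i < j`
gets the color `i / 2`. -/
def ladColoring (d : ℕ) (hd : 0 < d) (e : Sym2 (Fin (2 * d + 1))) : Fin d :=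
  ⟨min (if (e.inf : ℕ) % 2 = 0 ∧ (e.sup : ℕ) = e.inf + 1 then d - 1 else (e.inf : ℕ) / 2) (d - 1),
    by omega⟩

theorem ladColoring_mk_val {d : ℕ} (hd : 0 < d) {i j : Fin (2 * d + 1)} (h : i < j) :
    (ladColoring d hd s(i, j) : ℕ) =
      if (i : ℕ) % 2 = 0 ∧ (j : ℕ) = i + 1 then d - 1 else (i : ℕ) / 2 := by
  have hinf : (s(i, j) : Sym2 (Fin (2 * d + 1))).inf = i := by simp [h.le]
  have hsup : (s(i, j) : Sym2 (Fin (2 * d + 1))).sup = j := by simp [h.le]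
  simp only [ladColoring, hinf, hsup]
  have := j.isLt
  rw [Fin.lt_def] at h
  split_ifs <;> omega

/-- Moving up by two as long as possible gives a walk of length `⌈(j - i) / 2⌉` whose
colors increase strictly. -/
theorem exists_rainbow_walk_lad {d : ℕ} (hd : 0 < d) (i j : Fin (2 * d + 1)) (hij : i ≤ j) :
    ∃ p : (lad (2 * d + 1)).Walk i j, 2 * p.length ≤ j - i + 1 ∧
      (p.edges.map (ladColoring d hd)).Nodup ∧
      ∀ c ∈ p.edges.map (ladColoring d hd), (i : ℕ) / 2 ≤ c := by
  have hj := j.isLt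
  rw [Fin.le_def] at hij
  obtain h | h | h : (j : ℕ) = i ∨ (j : ℕ) = i + 1 ∨ (i : ℕ) + 2 ≤ j := by omega
  · obtain rfl := Fin.ext h
    exact ⟨.nil, by simp⟩
  · have hlt : i < j := by rw [Fin.lt_def]; omega
    have hadj : (lad (2 * d + 1)).Adj i j := lad_adj_iff.2 ⟨hlt.ne, by omega, by omega⟩
    refine ⟨.cons hadj .nil, ?_, by simp, ?_⟩
    · simp only [SimpleGraph.Walk.length_cons, SimpleGraph.Walk.length_nil]
      omega
    · simp only [SimpleGraph.Walk.edges_cons, SimpleGraph.Walk.edges_nil, List.map_cons,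
        List.map_nil, List.mem_singleton, forall_eq, ladColoring_mk_val hd hlt]
      split_ifs <;> omega
  · let k : Fin (2 * d + 1) := ⟨i + 2, by omega⟩
    have hk : (k : ℕ) = i + 2 := rfl
    have hlt : i < k := by rw [Fin.lt_def]; omega
    have hadj : (lad (2 * d + 1)).Adj i k := lad_adj_iff.2 ⟨hlt.ne, by omega, by omega⟩
    have hcol : (ladColoring d hd s(i, k) : ℕ) = i / 2 := by
      rw [ladColoring_mk_val hd hlt, if_neg (by omega)]
    obtain ⟨p, hlen, hnodup, hle⟩ := exists_rainbow_walk_lad hd k j (by rw [Fin.le_def]; omega)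
    refine ⟨.cons hadj p, ?_, ?_, ?_⟩
    · rw [SimpleGraph.Walk.length_cons]
      omega
    · rw [SimpleGraph.Walk.edges_cons, List.map_cons, List.nodup_cons]
      refine ⟨fun hmem => ?_, hnodup⟩
      have := hle _ hmem
      omega
    · rw [SimpleGraph.Walk.edges_cons, List.map_cons, List.forall_mem_cons]
      refine ⟨hcol.ge, fun c hc => ?_⟩
      have := hle c hc
      omega
termination_by (j : ℕ) - i

theorem isStrongRainbowColoring_ladColoring {d : ℕ} (hd : 0 < d) :
    IsStrongRainbowColoring (lad (2 * d + 1)) (ladColoring d hd) := by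
  have key (i j : Fin (2 * d + 1)) (hij : i ≤ j) : ∃ p : (lad (2 * d + 1)).Walk i j,
      p.IsPath ∧ (p.edges.map (ladColoring d hd)).Nodup ∧
        p.length = (lad (2 * d + 1)).dist i j := by
    obtain ⟨p, hlen, hnodup, -⟩ := exists_rainbow_walk_lad hd i j hij
    obtain ⟨q, hq⟩ := p.reachable.exists_walk_length_eq_dist
    have hle := SimpleGraph.dist_le p
    have hge := le_add_two_mul_length_of_walk_lad q
    rw [Fin.le_def] at hij
    have hp : p.length = (lad (2 * d + 1)).dist i j := by omega
    exact ⟨p, p.isPath_of_length_eq_dist hp, hnodup, hp⟩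
  intro u v
  obtain h | h := le_total u v
  · exact key u v h
  · obtain ⟨p, hpath, hnodup, hlen⟩ := key v u h
    refine ⟨p.reverse, hpath.reverse, ?_, ?_⟩
    · rwa [SimpleGraph.Walk.edges_reverse, List.map_reverse, List.nodup_reverse]
    · rw [SimpleGraph.Walk.length_reverse, hlen, SimpleGraph.dist_comm]

/-- For every `d ≥ 2`, the graph `Lad_{d+}` (the square of the path on `2d+1` vertices)
has strong rainbow connection number `d`. -/
theorem ladPlus_src (d : ℕ) (hd : 2 ≤ d) : src (lad (2 * d + 1)) = d := by
  have hmem : d ∈ {n : ℕ | ∃ c : Sym2 (Fin (2 * d + 1)) → Fin n,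
      IsStrongRainbowColoring (lad (2 * d + 1)) c} :=
    ⟨_, isStrongRainbowColoring_ladColoring (by omega)⟩
  refine le_antisymm (Nat.sInf_le hmem) (le_csInf ⟨d, hmem⟩ ?_)
  rintro n ⟨c, hc⟩
  obtain ⟨p, -, hnodup, -⟩ := hc 0 (Fin.last (2 * d))
  have hcard := hnodup.length_le_card
  rw [List.length_map, SimpleGraph.Walk.length_edges, Fintype.card_fin] at hcard
  have hlen := le_add_two_mul_length_of_walk_lad p
  rw [Fin.val_last, Fin.val_zero] at hlen
  omega
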